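/- arXiv:1802.10178 — 4 statements merged into one kernel-verified Lean document; each statement's English description precedes it below -/
import Mathlib

section
/- Let Z = m_0P_0 + m_1P_1 + m_2P_2 be a fat point scheme at three noncollinear points (taken to be the coordinate points) of P^N with m_0 ≤ m_1 ≤ m_2. If m_0 + m_1 > m_2 and m_0 + m_1 + m_2 is even, then I(Z)^{(m)} = I(Z)^m for all m ∈ ℕ, and hence ρ(I(Z)) = 1 (the ideal being nonzero and proper since m_2 ≥ 1). -/
/-- The ideal of the `j`-th coordinate point of `P^N`, generated by all
variables `x_i` with `i ≠ j`. -/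
noncomputable def ptIdeal (K : Type*) [Field K] (N : ℕ) (j : Fin (N + 1)) :
    Ideal (MvPolynomial (Fin (N + 1)) K) :=
  Ideal.span {f | ∃ i : Fin (N + 1), i ≠ j ∧ f = MvPolynomial.X i}

/-- The resurgence `ρ(I) = sup { m/r : I^{(m)} ⊄ I^r }` of an ideal `I` whose
`m`-th symbolic power is `symb m`. -/
noncomputable def resurgence {R : Type*} [CommRing R] (I : Ideal R) (symb : ℕ → Ideal R) : ℝ :=
  sSup {x : ℝ | ∃ m r : ℕ, 0 < m ∧ 0 < r ∧ ¬ symb m ≤ I ^ r ∧ x = (m : ℝ) / (r : ℝ)}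

/-- Division by `m + 1` is monotone and `1`-Lipschitz on the integers, and it splits every
`u ≤ (m + 1) * e` into a part bounded by `e` and a part bounded by `m * e`. -/
theorem exists_balanced_splitting (m : ℤ) (hm : 0 ≤ m) :
    ∃ q : ℤ → ℤ, (∀ u, 0 ≤ u → 0 ≤ q u ∧ q u ≤ u) ∧
      (∀ u v, u ≤ v → q u ≤ q v ∧ u - q u ≤ v - q v) ∧
      (∀ u e, u ≤ (m + 1) * e → q u ≤ e ∧ u - q u ≤ m * e) := by
  have hpos : 0 < m + 1 := by omega
  refine ⟨fun u => u / (m + 1), fun u hu => ⟨Int.ediv_nonneg hu hpos.le,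
    Int.ediv_le_self _ hu⟩, fun u v huv => ⟨Int.ediv_le_ediv hpos huv, ?_⟩, fun u e hue => ?_⟩
  · have h1 := Int.mul_ediv_add_emod u (m + 1)
    have h2 := Int.emod_lt_of_pos u hpos
    have h3 : v / (m + 1) ≤ u / (m + 1) + (v - u) := by
      rw [← Int.lt_add_one_iff, Int.ediv_lt_iff_lt_mul hpos]
      nlinarith
    dsimp only
    omega
  · have h1 := Int.mul_ediv_add_emod u (m + 1)
    have h2 := Int.emod_lt_of_pos u hpos
    have h3 := Int.emod_nonneg u hpos.ne'
    have h4 : u / (m + 1) ≤ e := Int.ediv_le_of_le_mul hpos (by linarith)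
    refine ⟨h4, ?_⟩
    dsimp only
    rcases h4.lt_or_eq with h5 | h5
    · nlinarith
    · rw [h5] at h1 ⊢
      linarith

theorem exists_excess_splitting_of_le {m e0 e1 e2 t0 t1 t2 c : ℤ} (hm : 0 ≤ m)
    (he0 : 0 ≤ e0) (he1 : 0 ≤ e1) (he2 : 0 ≤ e2)
    (ht0 : 0 ≤ (m + 1) * e0 + t0) (ht1 : 0 ≤ (m + 1) * e1 + t1) (ht2 : 0 ≤ (m + 1) * e2 + t2)
    (hc : 0 ≤ c) (h01 : t0 ≤ t1) (h12 : t1 ≤ t2) (hsum : 0 ≤ t0 + t1 + c) :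
    ∃ s0 s1 s2 d : ℤ, (0 ≤ d ∧ 0 ≤ e0 + s0 ∧ 0 ≤ e1 + s1 ∧ 0 ≤ e2 + s2 ∧
        0 ≤ s0 + s1 + d ∧ 0 ≤ s0 + s2 + d ∧ 0 ≤ s1 + s2 + d) ∧
      (0 ≤ c - d ∧ 0 ≤ m * e0 + (t0 - s0) ∧ 0 ≤ m * e1 + (t1 - s1) ∧ 0 ≤ m * e2 + (t2 - s2) ∧
        0 ≤ (t0 - s0) + (t1 - s1) + (c - d) ∧ 0 ≤ (t0 - s0) + (t2 - s2) + (c - d) ∧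
        0 ≤ (t1 - s1) + (t2 - s2) + (c - d)) := by
  obtain ⟨q, hq, hmono, hle⟩ := exists_balanced_splitting m hm
  have a0 := hq (-t0)
  have a1 := hq (-t1)
  have a2 := hq (-t2)
  have b01 := hmono (-t1) (-t0) (by omega)
  have b12 := hmono (-t2) (-t1) (by omega)
  have c0 := hle (-t0) e0 (by linarith)
  have c1 := hle (-t1) e1 (by linarith)
  have c2 := hle (-t2) e2 (by linarith)
  have d0 := mul_nonneg hm he0
  have d1 := mul_nonneg hm he1
  have d2 := mul_nonneg hm he2
  generalize m * e0 = f0 at *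
  generalize m * e1 = f1 at *
  generalize m * e2 = f2 at *
  generalize q (-t0) = q0 at *
  generalize q (-t1) = q1 at *
  generalize q (-t2) = q2 at *
  clear hq hmono hle ht0 ht1 ht2
  rcases le_or_gt 0 t0 with h | h
  · exact ⟨0, 0, 0, 0, by omega, by omega⟩
  rcases le_or_gt 0 t1 with h' | h'
  · rcases le_or_gt q0 c with h'' | h''
    · exact ⟨-q0, 0, 0, q0, by omega, by omega⟩
    · exact ⟨-q0, q0 - c, q0 - c, c, by omega, by omega⟩
  rcases le_or_gt 0 t2 with h'' | h''
  · exact ⟨-q0, -q1, 0, q0 + q1, by omega, by omega⟩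
  · exact ⟨-q0, -q1, -q2, q0 + q1, by omega, by omega⟩

theorem exists_excess_splitting {m e0 e1 e2 t0 t1 t2 c : ℤ} (hm : 0 ≤ m)
    (he0 : 0 ≤ e0) (he1 : 0 ≤ e1) (he2 : 0 ≤ e2)
    (ht0 : 0 ≤ (m + 1) * e0 + t0) (ht1 : 0 ≤ (m + 1) * e1 + t1) (ht2 : 0 ≤ (m + 1) * e2 + t2)
    (hc : 0 ≤ c) (h01 : 0 ≤ t0 + t1 + c) (h02 : 0 ≤ t0 + t2 + c) (h12 : 0 ≤ t1 + t2 + c) :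
    ∃ s0 s1 s2 d : ℤ, (0 ≤ d ∧ 0 ≤ e0 + s0 ∧ 0 ≤ e1 + s1 ∧ 0 ≤ e2 + s2 ∧
        0 ≤ s0 + s1 + d ∧ 0 ≤ s0 + s2 + d ∧ 0 ≤ s1 + s2 + d) ∧
      (0 ≤ c - d ∧ 0 ≤ m * e0 + (t0 - s0) ∧ 0 ≤ m * e1 + (t1 - s1) ∧ 0 ≤ m * e2 + (t2 - s2) ∧
        0 ≤ (t0 - s0) + (t1 - s1) + (c - d) ∧ 0 ≤ (t0 - s0) + (t2 - s2) + (c - d) ∧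
        0 ≤ (t1 - s1) + (t2 - s2) + (c - d)) := by
  rcases le_total t0 t1 with hle01 | hle01 <;> rcases le_total t1 t2 with hle12 | hle12 <;>
    rcases le_total t0 t2 with hle02 | hle02
  · exact exists_excess_splitting_of_le hm he0 he1 he2 ht0 ht1 ht2 hc hle01 hle12 h01
  · exact exists_excess_splitting_of_le hm he0 he1 he2 ht0 ht1 ht2 hc hle01 hle12 h01
  · obtain ⟨s0, s2, s1, d, h, h'⟩ :=
      exists_excess_splitting_of_le hm he0 he2 he1 ht0 ht2 ht1 hc hle02 hle12 h02
    exact ⟨s0, s1, s2, d, by omega, by omega⟩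
  · obtain ⟨s2, s0, s1, d, h, h'⟩ :=
      exists_excess_splitting_of_le hm he2 he0 he1 ht2 ht0 ht1 hc hle02 hle01 (by omega)
    exact ⟨s0, s1, s2, d, by omega, by omega⟩
  · obtain ⟨s1, s0, s2, d, h, h'⟩ :=
      exists_excess_splitting_of_le hm he1 he0 he2 ht1 ht0 ht2 hc hle01 hle02 (by omega)
    exact ⟨s0, s1, s2, d, by omega, by omega⟩
  · obtain ⟨s1, s2, s0, d, h, h'⟩ :=
      exists_excess_splitting_of_le hm he1 he2 he0 ht1 ht2 ht0 hc hle12 hle02 (by omega)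
    exact ⟨s0, s1, s2, d, by omega, by omega⟩
  · obtain ⟨s2, s1, s0, d, h, h'⟩ :=
      exists_excess_splitting_of_le hm he2 he1 he0 ht2 ht1 ht0 hc hle12 hle01 (by omega)
    exact ⟨s0, s1, s2, d, by omega, by omega⟩
  · obtain ⟨s2, s1, s0, d, h, h'⟩ :=
      exists_excess_splitting_of_le hm he2 he1 he0 ht2 ht1 ht0 hc hle12 hle01 (by omega)
    exact ⟨s0, s1, s2, d, by omega, by omega⟩

/-- The exponents `(a0, a1, a2)` at the three points, with total exponent `c` in the remaining
variables, of a monomial in `I((m + 1)Z)` split off the exponents of a monomial in `I(Z)`, leaving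
those of a monomial in `I(mZ)`. -/
theorem exists_exponent_splitting {m m0 m1 m2 a0 a1 a2 c : ℕ}
    (h0 : m0 ≤ m1 + m2) (h1 : m1 ≤ m0 + m2) (h2 : m2 ≤ m0 + m1) (heven : Even (m0 + m1 + m2))
    (ha0 : (m + 1) * m0 ≤ a1 + a2 + c) (ha1 : (m + 1) * m1 ≤ a0 + a2 + c)
    (ha2 : (m + 1) * m2 ≤ a0 + a1 + c) :
    ∃ b0 b1 b2 d b0' b1' b2' d' : ℕ, b0 + b0' = a0 ∧ b1 + b1' = a1 ∧ b2 + b2' = a2 ∧ d + d' = c ∧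
      m0 ≤ b1 + b2 + d ∧ m1 ≤ b0 + b2 + d ∧ m2 ≤ b0 + b1 + d ∧
      m * m0 ≤ b1' + b2' + d' ∧ m * m1 ≤ b0' + b2' + d' ∧ m * m2 ≤ b0' + b1' + d' := by
  obtain ⟨s, hs⟩ := heven
  obtain ⟨e0, he0⟩ := Nat.exists_eq_add_of_le (show m0 ≤ s by omega)
  obtain ⟨e1, he1⟩ := Nat.exists_eq_add_of_le (show m1 ≤ s by omega)
  obtain ⟨e2, he2⟩ := Nat.exists_eq_add_of_le (show m2 ≤ s by omega)
  obtain rfl : m0 = e1 + e2 := by omega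
  obtain rfl : m1 = e0 + e2 := by omega
  obtain rfl : m2 = e0 + e1 := by omega
  zify at ha0 ha1 ha2
  obtain ⟨s0, s1, s2, d, ⟨p0, p1, p2, p3, p4, p5, p6⟩, r0, r1, r2, r3, r4, r5, r6⟩ :=
    exists_excess_splitting (m := m) (e0 := e0) (e1 := e1) (e2 := e2)
      (t0 := a0 - (m + 1) * e0) (t1 := a1 - (m + 1) * e1) (t2 := a2 - (m + 1) * e2) (c := c)
      (by positivity) (by positivity) (by positivity) (by positivity) (by simp) (by simp)
      (by simp) (by positivity) (by linarith) (by linarith) (by linarith)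
  refine ⟨(e0 + s0).toNat, (e1 + s1).toNat, (e2 + s2).toNat, d.toNat,
    (a0 - (e0 + s0)).toNat, (a1 - (e1 + s1)).toNat, (a2 - (e2 + s2)).toNat, (c - d).toNat, ?_⟩
  have k0 : (0 : ℤ) ≤ a0 - (e0 + s0) := by linarith
  have k1 : (0 : ℤ) ≤ a1 - (e1 + s1) := by linarith
  have k2 : (0 : ℤ) ≤ a2 - (e2 + s2) := by linarith
  zify
  rw [Int.toNat_of_nonneg p0, Int.toNat_of_nonneg p1, Int.toNat_of_nonneg p2,
    Int.toNat_of_nonneg p3, Int.toNat_of_nonneg r0, Int.toNat_of_nonneg k0,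
    Int.toNat_of_nonneg k1, Int.toNat_of_nonneg k2]
  refine ⟨?_, ?_, ?_, ?_, ?_, ?_, ?_, ?_, ?_, ?_⟩ <;> linarith

/-- An exponent vector on a type with three distinguished distinct indices is determined by its
values there and a part supported elsewhere. -/
theorem Finsupp.exists_eq_single_add_single_add_single_add {σ : Type*} {i j k : σ}
    (hij : i ≠ j) (hik : i ≠ k) (hjk : j ≠ k) (a : σ →₀ ℕ) :
    ∃ g : σ →₀ ℕ, g i = 0 ∧ g j = 0 ∧ g k = 0 ∧
      a = single i (a i) + single j (a j) + single k (a k) + g := by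
  classical
  refine ⟨((a.erase i).erase j).erase k, by simp [erase_ne, hij, hik], by simp [erase_ne, hjk],
    by simp, ?_⟩
  ext x
  by_cases hi : x = i
  · subst hi
    simp [hij, hik, erase_ne]
  by_cases hj : x = j
  · subst hj
    simp [hjk, hij.symm, erase_ne]
  by_cases hk : x = k
  · subst hk
    simp [hik.symm, hjk.symm]
  · simp [erase_ne, hi, hj, hk]

/-- A monomial of exponent `a` with `k_l + a_l ≤ deg a` at three indices, where `k = (m + 1) • (m0,
m1, m2)`, splits as a sum of exponents with the same property for `(m0, m1, m2)` and
`m • (m0, m1, m2)`. -/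
theorem Finsupp.exists_add_eq_of_fat_points {σ : Type*} {i j k : σ}
    (hij : i ≠ j) (hik : i ≠ k) (hjk : j ≠ k) {m m0 m1 m2 : ℕ}
    (h0 : m0 ≤ m1 + m2) (h1 : m1 ≤ m0 + m2) (h2 : m2 ≤ m0 + m1) (heven : Even (m0 + m1 + m2))
    {a : σ →₀ ℕ} (ha0 : (m + 1) * m0 + a i ≤ a.degree) (ha1 : (m + 1) * m1 + a j ≤ a.degree)
    (ha2 : (m + 1) * m2 + a k ≤ a.degree) :
    ∃ b b' : σ →₀ ℕ, b + b' = a ∧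
      (m0 + b i ≤ b.degree ∧ m1 + b j ≤ b.degree ∧ m2 + b k ≤ b.degree) ∧
      m * m0 + b' i ≤ b'.degree ∧ m * m1 + b' j ≤ b'.degree ∧ m * m2 + b' k ≤ b'.degree := by
  obtain ⟨g, gi, gj, gk, hg⟩ := exists_eq_single_add_single_add_single_add hij hik hjk a
  have hdeg : a.degree = a i + a j + a k + g.degree := by
    conv_lhs => rw [hg]
    simp
  obtain ⟨b0, b1, b2, d, b0', b1', b2', d', q0, q1, q2, q3, r0, r1, r2, r0', r1', r2'⟩ :=
    exists_exponent_splitting (m := m) (a0 := a i) (a1 := a j) (a2 := a k) (c := g.degree)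
      h0 h1 h2 heven (by omega) (by omega) (by omega)
  obtain ⟨h, hhg, hh⟩ := exists_le_degree_eq g d (by omega)
  obtain ⟨h', rfl⟩ := exists_add_of_le hhg
  rw [map_add] at q3
  simp only [add_apply, Nat.add_eq_zero_iff] at gi gj gk
  refine ⟨single i b0 + single j b1 + single k b2 + h,
    single i b0' + single j b1' + single k b2' + h', ?_, ?_, ?_⟩
  · rw [hg, ← q0, ← q1, ← q2]
    simp only [single_add]
    abel
  · simp [hij, hik, hjk, hij.symm, hik.symm, hjk.symm, gi, gj, gk]
    omega
  · simp [hij, hik, hjk, hij.symm, hik.symm, hjk.symm, gi, gj, gk]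
    omega

/-- The ideal of polynomials all of whose monomials have degree at least `k` in the variables other
than `j`. -/
def MvPolynomial.pointOrderIdeal {σ : Type*} (R : Type*) [CommRing R] (j : σ) (k : ℕ) :
    Ideal (MvPolynomial σ R) where
  carrier := {f | ∀ a ∈ f.support, k + a j ≤ a.degree}
  zero_mem' := by simp
  add_mem' := by
    classical
    intro f g hf hg a ha
    rcases Finset.mem_union.1 (support_add ha) with h | h
    exacts [hf a h, hg a h]
  smul_mem' := by
    classical
    intro f g hg a ha
    obtain ⟨b, -, c, hc, rfl⟩ := Finset.mem_add.1 (support_mul f g ha)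
    have h1 := hg c hc
    have h2 := Finsupp.le_degree j b
    simp only [Finsupp.add_apply, map_add]
    omega

theorem MvPolynomial.mem_pointOrderIdeal {σ R : Type*} [CommRing R] {j : σ} {k : ℕ}
    {f : MvPolynomial σ R} :
    f ∈ pointOrderIdeal R j k ↔ ∀ a ∈ f.support, k + a j ≤ a.degree :=
  Iff.rfl

theorem MvPolynomial.pointOrderIdeal_mul_le {σ R : Type*} [CommRing R] {j : σ} {k l : ℕ} :
    pointOrderIdeal R j k * pointOrderIdeal R j l ≤ pointOrderIdeal R j (k + l) := by
  classical
  refine Ideal.mul_le.2 fun f hf g hg a ha => ?_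
  obtain ⟨b, hb, c, hc, rfl⟩ := Finset.mem_add.1 (support_mul f g ha)
  have h1 := hf b hb
  have h2 := hg c hc
  simp only [Finsupp.add_apply, map_add]
  omega

theorem monomial_mem_ptIdeal_pow {K : Type*} [Field K] {N : ℕ} {j : Fin (N + 1)} {k : ℕ}
    {a : Fin (N + 1) →₀ ℕ} (ha : k + a j ≤ a.degree) (c : K) :
    MvPolynomial.monomial a c ∈ ptIdeal K N j ^ k := by
  classical
  rw [MvPolynomial.monomial_eq, Finsupp.prod_fintype _ _ (by simp),
    ← Finset.mul_prod_erase _ _ (Finset.mem_univ j)]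
  refine Ideal.mul_mem_left _ _ (Ideal.mul_mem_left _ _ ?_)
  have hk : k ≤ ∑ i ∈ Finset.univ.erase j, a i := by
    rw [Finsupp.degree_eq_sum, ← Finset.add_sum_erase _ _ (Finset.mem_univ j)] at ha
    omega
  refine Ideal.pow_le_pow_right hk ?_
  rw [← Finset.prod_pow_eq_pow_sum]
  refine Ideal.prod_mem_prod fun i hi => Ideal.pow_mem_pow ?_ _
  exact Ideal.subset_span ⟨i, Finset.ne_of_mem_erase hi, rfl⟩

theorem ptIdeal_pow_eq_pointOrderIdeal (K : Type*) [Field K] (N : ℕ) (j : Fin (N + 1)) (k : ℕ) :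
    ptIdeal K N j ^ k = MvPolynomial.pointOrderIdeal K j k := by
  apply le_antisymm
  · induction k with
    | zero =>
      intro f _ a _
      simpa using Finsupp.le_degree j a
    | succ k ih =>
      rw [pow_succ]
      refine (Ideal.mul_mono ih ?_).trans MvPolynomial.pointOrderIdeal_mul_le
      refine Ideal.span_le.2 ?_
      rintro f ⟨i, hi, rfl⟩ a ha
      rw [MvPolynomial.support_X, Finset.mem_singleton] at ha
      subst ha
      simp [hi]
  · intro f hf
    rw [MvPolynomial.as_sum f]
    exact Ideal.sum_mem _ fun a ha => monomial_mem_ptIdeal_pow (hf a ha) _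

theorem fat_points_symbolic_eq_pow {K : Type*} [Field K] {N : ℕ} {i j k : Fin (N + 1)}
    (hij : i ≠ j) (hik : i ≠ k) (hjk : j ≠ k) {m0 m1 m2 : ℕ}
    (h0 : m0 ≤ m1 + m2) (h1 : m1 ≤ m0 + m2) (h2 : m2 ≤ m0 + m1) (heven : Even (m0 + m1 + m2))
    (m : ℕ) :
    ptIdeal K N i ^ (m * m0) ⊓ ptIdeal K N j ^ (m * m1) ⊓ ptIdeal K N k ^ (m * m2) =
      (ptIdeal K N i ^ m0 ⊓ ptIdeal K N j ^ m1 ⊓ ptIdeal K N k ^ m2) ^ m := by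
  apply le_antisymm
  · have key : ∀ (m : ℕ) (a : Fin (N + 1) →₀ ℕ), m * m0 + a i ≤ a.degree →
        m * m1 + a j ≤ a.degree → m * m2 + a k ≤ a.degree → ∀ c : K,
        MvPolynomial.monomial a c ∈
          (ptIdeal K N i ^ m0 ⊓ ptIdeal K N j ^ m1 ⊓ ptIdeal K N k ^ m2) ^ m := by
      intro m
      induction m with
      | zero => simp
      | succ m ih =>
        intro a ha0 ha1 ha2 c
        obtain ⟨b, b', rfl, ⟨p0, p1, p2⟩, r0, r1, r2⟩ :=
          Finsupp.exists_add_eq_of_fat_points hij hik hjk h0 h1 h2 heven ha0 ha1 ha2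
        rw [pow_succ', ← one_mul c, ← MvPolynomial.monomial_mul]
        exact Ideal.mul_mem_mul
          ⟨⟨monomial_mem_ptIdeal_pow p0 1, monomial_mem_ptIdeal_pow p1 1⟩,
            monomial_mem_ptIdeal_pow p2 1⟩ (ih b' r0 r1 r2 c)
    rintro f ⟨⟨hf0, hf1⟩, hf2⟩
    simp only [SetLike.mem_coe, ptIdeal_pow_eq_pointOrderIdeal,
      MvPolynomial.mem_pointOrderIdeal] at hf0 hf1 hf2
    rw [MvPolynomial.as_sum f]
    exact Ideal.sum_mem _ fun a ha => key m a (hf0 a ha) (hf1 a ha) (hf2 a ha) _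
  · simp only [mul_comm m, pow_mul]
    exact le_inf (le_inf (Ideal.pow_right_mono (inf_le_left.trans inf_le_left) m)
      (Ideal.pow_right_mono (inf_le_left.trans inf_le_right) m))
      (Ideal.pow_right_mono inf_le_right m)

theorem Ideal.not_pow_le_pow_succ {R : Type*} [CommRing R] [IsDomain R] [IsNoetherianRing R]
    {I : Ideal R} (hbot : I ≠ ⊥) (htop : I ≠ ⊤) (m : ℕ) : ¬ I ^ m ≤ I ^ (m + 1) := by
  intro h
  have hle : ∀ n, I ^ m ≤ I ^ n := by
    intro n
    induction n with
    | zero => simp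
    | succ n ih =>
      rcases le_or_gt (n + 1) m with hn | hn
      · exact Ideal.pow_le_pow_right hn
      · calc I ^ m ≤ I ^ (m + 1) := h
          _ = I * I ^ m := pow_succ' I m
          _ ≤ I * I ^ n := Ideal.mul_mono_right ih
          _ = I ^ (n + 1) := (pow_succ' I n).symm
  have := le_iInf hle
  rw [Ideal.iInf_pow_eq_bot_of_isDomain I htop, le_bot_iff] at this
  exact pow_ne_zero m hbot this

theorem resurgence_pow_eq_one {R : Type*} [CommRing R] [IsDomain R] [IsNoetherianRing R]
    {I : Ideal R} (hbot : I ≠ ⊥) (htop : I ≠ ⊤) : resurgence I (fun m => I ^ m) = 1 := by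
  refine csSup_eq_of_forall_le_of_forall_lt_exists_gt ?_ ?_ ?_
  · exact ⟨_, 1, 2, one_pos, two_pos, Ideal.not_pow_le_pow_succ hbot htop 1, rfl⟩
  · rintro x ⟨m, r, -, hr, hmr, rfl⟩
    rw [div_le_one (by exact_mod_cast hr)]
    by_contra hlt
    exact hmr (Ideal.pow_le_pow_right (by exact_mod_cast (not_le.1 hlt).le))
  · intro w hw
    obtain ⟨n, hn⟩ := exists_nat_one_div_lt (sub_pos.2 hw)
    refine ⟨_, ⟨n + 1, n + 2, by omega, by omega, Ideal.not_pow_le_pow_succ hbot htop (n + 1),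
      rfl⟩, ?_⟩
    have h1 : ((n + 1 : ℕ) : ℝ) / ((n + 2 : ℕ) : ℝ) = 1 - 1 / ((n : ℝ) + 2) := by
      push_cast
      field_simp
      ring
    have h2 : 1 / ((n : ℝ) + 2) ≤ 1 / ((n : ℝ) + 1) := by gcongr; norm_num
    rw [h1]
    linarith

theorem ptIdeal_ne_bot (K : Type*) [Field K] {N : ℕ} (hN : 1 ≤ N) (j : Fin (N + 1)) :
    ptIdeal K N j ≠ ⊥ := by
  have : Nontrivial (Fin (N + 1)) := Fin.nontrivial_iff_two_le.2 (by omega)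
  obtain ⟨i, hi⟩ := exists_ne j
  intro h
  have hX : (MvPolynomial.X i : MvPolynomial (Fin (N + 1)) K) ∈ ptIdeal K N j :=
    Ideal.subset_span ⟨i, hi, rfl⟩
  rw [h, Ideal.mem_bot] at hX
  exact MvPolynomial.X_ne_zero i hX

theorem ptIdeal_pow_ne_top (K : Type*) [Field K] (N : ℕ) (j : Fin (N + 1)) {k : ℕ} (hk : 0 < k) :
    ptIdeal K N j ^ k ≠ ⊤ := by
  rw [Ideal.ne_top_iff_one, ptIdeal_pow_eq_pointOrderIdeal, MvPolynomial.mem_pointOrderIdeal]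
  intro h
  have := h 0 (by simp)
  simp at this
  omega

/-- For `Z = m_0 P_0 + m_1 P_1 + m_2 P_2` at three noncollinear (coordinate) points of `P^N`
with `m_0 ≤ m_1 ≤ m_2`, if `m_0 + m_1 > m_2` and `m_0 + m_1 + m_2` is even, then
`I(Z)^{(m)} = I(Z)^m` for all `m`, and hence `ρ(I(Z)) = 1`. -/
theorem three_points_even_case_symbolic_eq_ordinary
    (K : Type*) [Field K] (N : ℕ) (hN : 2 ≤ N) (m0 m1 m2 : ℕ)
    (h01 : m0 ≤ m1) (h12 : m1 ≤ m2)
    (hgt : m2 < m0 + m1) (heven : Even (m0 + m1 + m2)) :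
    (∀ m : ℕ,
      ptIdeal K N 0 ^ (m * m0) ⊓ ptIdeal K N 1 ^ (m * m1) ⊓ ptIdeal K N 2 ^ (m * m2) =
        (ptIdeal K N 0 ^ m0 ⊓ ptIdeal K N 1 ^ m1 ⊓ ptIdeal K N 2 ^ m2) ^ m) ∧
    resurgence (ptIdeal K N 0 ^ m0 ⊓ ptIdeal K N 1 ^ m1 ⊓ ptIdeal K N 2 ^ m2)
      (fun m =>
        ptIdeal K N 0 ^ (m * m0) ⊓ ptIdeal K N 1 ^ (m * m1) ⊓ ptIdeal K N 2 ^ (m * m2)) = 1 := by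
  have h01' : (0 : Fin (N + 1)) ≠ 1 := by
    rw [Ne, Fin.ext_iff]
    simp [Nat.mod_eq_of_lt (show 1 < N + 1 by omega)]
  have h02' : (0 : Fin (N + 1)) ≠ 2 := by
    rw [Ne, Fin.ext_iff]
    simp [Nat.mod_eq_of_lt (show 2 < N + 1 by omega)]
  have h12' : (1 : Fin (N + 1)) ≠ 2 := by
    rw [Ne, Fin.ext_iff]
    simp [Nat.mod_eq_of_lt (show 1 < N + 1 by omega), Nat.mod_eq_of_lt (show 2 < N + 1 by omega)]
  have hsymb := fat_points_symbolic_eq_pow (K := K) h01' h02' h12' (m0 := m0) (m1 := m1)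
    (m2 := m2) (by omega) (by omega) (by omega) heven
  refine ⟨hsymb, ?_⟩
  simp only [hsymb]
  refine resurgence_pow_eq_one ?_ ?_
  · have hbot : ∀ (j : Fin (N + 1)) (k : ℕ), ptIdeal K N j ^ k ≠ ⊥ := fun j k =>
      pow_ne_zero k (ptIdeal_ne_bot K (by omega) j)
    intro h
    refine mul_ne_zero (mul_ne_zero (hbot 0 m0) (hbot 1 m1)) (hbot 2 m2) (le_bot_iff.1 ?_)
    exact ((Ideal.mul_mono_left Ideal.mul_le_inf).trans Ideal.mul_le_inf).trans h.le
  · exact fun h => ptIdeal_pow_ne_top K N 2 (k := m2) (by omega) (top_le_iff.1 (h ▸ inf_le_right))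
end

section
/- Let Z = m_0P_0 + m_1P_1 + m_2P_2 be a fat point scheme at three noncollinear points (taken to be the coordinate points) of P^N with m_0 ≤ m_1 ≤ m_2, m_0 + m_1 > m_2, and m_0 + m_1 + m_2 odd. Then for every k ∈ ℕ: I(Z)^{(k)} = (⋂_{i=0}^2 I(P_i)^k) · (⋂_{i=0}^2 I(P_i)^{k(m_i−1)}) = (⋂_{i=0}^2 I(P_i)^k) · (⋂_{i=0}^2 I(P_i)^{m_i−1})^k; that is, I(Z)^{(k)} = I(P_0+P_1+P_2)^{(k)} · I((m_0−1)P_0+(m_1−1)P_1+(m_2−1)P_2)^{(k)} and the second factor's k-th symbolic power equals its k-th ordinary power. -/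
open MvPolynomial in
/-- The product of two monomial ideals is generated by the products of their monomials. -/
theorem span_monomial_image_mul {σ R : Type*} [CommSemiring R] (S T : Set (σ →₀ ℕ)) :
    Ideal.span ((fun s ↦ monomial s (1 : R)) '' S) * Ideal.span ((fun s ↦ monomial s (1 : R)) '' T)
      = Ideal.span ((fun s ↦ monomial s (1 : R)) '' Set.image2 (· + ·) S T) := by
  rw [Ideal.span_mul_span']
  congr 1
  rw [← Set.image2_mul, Set.image2_image_left, Set.image2_image_right, Set.image_image2]
  simp only [monomial_mul, one_mul]

theorem Finsupp.degree_erase_add {σ : Type*} (e : σ →₀ ℕ) (j : σ) :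
    (e.erase j).degree + e j = e.degree := by
  conv_rhs => rw [← Finsupp.erase_add_single j e]
  rw [map_add, Finsupp.degree_single]

theorem ptIdeal_eq_span_monomial (K : Type*) [Field K] (N : ℕ) (j : Fin (N + 1)) :
    ptIdeal K N j = Ideal.span ((fun s ↦ MvPolynomial.monomial s (1 : K)) ''
      ((fun i ↦ Finsupp.single i 1) '' {i | i ≠ j})) := by
  rw [ptIdeal, Set.image_image]
  congr 1
  ext f
  simp [MvPolynomial.X, eq_comm]

theorem ptIdeal_pow_eq_span_monomial (K : Type*) [Field K] (N : ℕ) (j : Fin (N + 1)) (a : ℕ) :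
    ptIdeal K N j ^ a = Ideal.span ((fun s ↦ MvPolynomial.monomial s (1 : K)) ''
      {e | e j = 0 ∧ e.degree = a}) := by
  induction a with
  | zero =>
    rw [pow_zero, Ideal.one_eq_top, eq_comm, Ideal.eq_top_iff_one]
    exact Ideal.subset_span ⟨0, by simp, rfl⟩
  | succ a ih =>
    rw [pow_succ, ih, ptIdeal_eq_span_monomial, span_monomial_image_mul]
    congr 2
    ext e
    simp only [Set.mem_image2, Set.mem_image, Set.mem_ofPred_eq]
    constructor
    · rintro ⟨f, ⟨hf0, hf⟩, _, ⟨i, hi, rfl⟩, rfl⟩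
      simp [hf0, hf, hi.symm, Finsupp.degree_single]
    · rintro ⟨he0, he⟩
      have hne : e ≠ 0 := by rintro rfl; simp at he
      obtain ⟨i, hi⟩ := Finsupp.ne_iff.mp hne
      have hle : Finsupp.single i 1 ≤ e := by
        rw [Finsupp.single_le_iff]; exact Nat.one_le_iff_ne_zero.mpr hi
      have hsum := tsub_add_cancel_of_le hle
      refine ⟨e - Finsupp.single i 1, ⟨by simp [he0], ?_⟩, _, ⟨i, ?_, rfl⟩, hsum⟩
      · have := congrArg Finsupp.degree hsum
        rw [map_add, Finsupp.degree_single] at this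
        omega
      · rintro rfl; exact hi he0

/-- A polynomial lies in the `a`-th power of the ideal of the coordinate point `P_j` iff each of
its monomials has degree at least `a` in the variables other than `x_j`. -/
theorem mem_ptIdeal_pow_iff {K : Type*} [Field K] {N : ℕ} {j : Fin (N + 1)} {a : ℕ}
    {x : MvPolynomial (Fin (N + 1)) K} :
    x ∈ ptIdeal K N j ^ a ↔ ∀ e ∈ x.support, a + e j ≤ e.degree := by
  rw [ptIdeal_pow_eq_span_monomial, MvPolynomial.mem_ideal_span_monomial_image]
  refine forall₂_congr fun e _ ↦ ?_
  have he := Finsupp.degree_erase_add e j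
  constructor
  · rintro ⟨f, ⟨hf0, hf⟩, hfe⟩
    have h := Finsupp.degree_mono (show f ≤ e.erase j from fun i ↦ by
      by_cases hi : i = j
      · simp [hi, hf0]
      · simpa [hi] using hfe i)
    omega
  · intro h
    obtain ⟨f, hfe, hf⟩ := Finsupp.exists_le_degree_eq (e.erase j) a (by omega)
    refine ⟨f, ⟨by simpa using hfe j, hf⟩, hfe.trans fun i ↦ ?_⟩
    by_cases hi : i = j
    · simp [hi]
    · simp [hi]

/-- Splitting of exponent vectors: `e₀, e₁, e₂` are the exponents of `x_0, x_1, x_2` and `r` is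
the total degree in the other variables. -/
theorem exists_exponent_splitting_s14 (r : ℕ) : ∀ a₀ a₁ a₂ b₀ b₁ b₂ e₀ e₁ e₂ : ℕ,
    a₀ ≤ a₁ → a₁ ≤ a₂ → a₂ ≤ a₀ + a₁ → b₀ ≤ b₁ → b₁ ≤ b₂ → b₂ ≤ b₀ + b₁ →
    (Even (a₀ + a₁ + a₂) ∨ Even (b₀ + b₁ + b₂)) →
    a₀ + b₀ ≤ e₁ + e₂ + r → a₁ + b₁ ≤ e₀ + e₂ + r → a₂ + b₂ ≤ e₀ + e₁ + r →
    ∃ f₀ f₁ f₂ s g₀ g₁ g₂ t : ℕ, f₀ + g₀ = e₀ ∧ f₁ + g₁ = e₁ ∧ f₂ + g₂ = e₂ ∧ s + t = r ∧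
      a₀ ≤ f₁ + f₂ + s ∧ a₁ ≤ f₀ + f₂ + s ∧ a₂ ≤ f₀ + f₁ + s ∧
      b₀ ≤ g₁ + g₂ + t ∧ b₁ ≤ g₀ + g₂ + t ∧ b₂ ≤ g₀ + g₁ + t := by
  induction r with
  | zero =>
    intro a₀ a₁ a₂ b₀ b₁ b₂ e₀ e₁ e₂ _ _ _ _ _ _ hev h₀ h₁ h₂
    wlog hb : Even (b₀ + b₁ + b₂) generalizing a₀ a₁ a₂ b₀ b₁ b₂
    · obtain ⟨f₀, f₁, f₂, s, g₀, g₁, g₂, t, h⟩ := this b₀ b₁ b₂ a₀ a₁ a₂ ‹_› ‹_› ‹_› ‹_› ‹_› ‹_›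
        hev.symm (by omega) (by omega) (by omega) (hev.resolve_right hb)
      exact ⟨g₀, g₁, g₂, t, f₀, f₁, f₂, s, by omega⟩
    obtain ⟨c, hc⟩ := hb
    obtain ⟨β₀, hβ₀⟩ : ∃ β, β + b₀ = c := ⟨c - b₀, by omega⟩
    obtain ⟨β₁, hβ₁⟩ : ∃ β, β + b₁ = c := ⟨c - b₁, by omega⟩
    obtain ⟨β₂, hβ₂⟩ : ∃ β, β + b₂ = c := ⟨c - b₂, by omega⟩
    by_cases k₀ : e₀ < β₀
    · exact ⟨0, e₁ - (b₂ - e₀), e₂ - (b₁ - e₀), 0, e₀, b₂ - e₀, b₁ - e₀, 0, by omega⟩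
    by_cases k₁ : e₁ < β₁
    · exact ⟨e₀ - (b₂ - e₁), 0, e₂ - (b₀ - e₁), 0, b₂ - e₁, e₁, b₀ - e₁, 0, by omega⟩
    by_cases k₂ : e₂ < β₂
    · exact ⟨e₀ - (b₁ - e₂), e₁ - (b₀ - e₂), 0, 0, b₁ - e₂, b₀ - e₂, e₂, 0, by omega⟩
    exact ⟨e₀ - β₀, e₁ - β₁, e₂ - β₂, 0, β₀, β₁, β₂, 0, by omega⟩
  | succ r ih =>
    intro a₀ a₁ a₂ b₀ b₁ b₂ e₀ e₁ e₂ _ _ _ _ _ _ hev h₀ h₁ h₂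
    by_cases ha : a₂ < a₀ + a₁ ∧ Even (b₀ + b₁ + b₂)
    · obtain ⟨f₀, f₁, f₂, s, g₀, g₁, g₂, t, h⟩ := ih (a₀ - 1) (a₁ - 1) (a₂ - 1) b₀ b₁ b₂ e₀ e₁ e₂
        (by omega) (by omega) (by omega) ‹_› ‹_› ‹_› (.inr ha.2) (by omega) (by omega) (by omega)
      exact ⟨f₀, f₁, f₂, s + 1, g₀, g₁, g₂, t, by omega⟩
    by_cases hb : b₂ < b₀ + b₁ ∧ Even (a₀ + a₁ + a₂)
    · obtain ⟨f₀, f₁, f₂, s, g₀, g₁, g₂, t, h⟩ := ih a₀ a₁ a₂ (b₀ - 1) (b₁ - 1) (b₂ - 1) e₀ e₁ e₂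
        ‹_› ‹_› ‹_› (by omega) (by omega) (by omega) (.inl hb.2) (by omega) (by omega) (by omega)
      exact ⟨f₀, f₁, f₂, s, g₀, g₁, g₂, t + 1, by omega⟩
    obtain rfl : a₂ = a₀ + a₁ := by grind
    obtain rfl : b₂ = b₀ + b₁ := by grind
    by_cases k₀ : e₀ < b₁
    · by_cases k₁ : e₁ < b₀
      · exact ⟨0, 0, e₂, r + 1 - (b₀ + b₁ - e₀ - e₁), e₀, e₁, 0, b₀ + b₁ - e₀ - e₁, by omega⟩
      · obtain ⟨y, hy⟩ : ∃ y, y = min (b₁ - e₀) (min (e₁ - b₀) e₂) := ⟨_, rfl⟩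
        exact ⟨0, e₁ - b₀ - y, e₂ - y, r + 1 - (b₁ - e₀ - y), e₀, b₀ + y, y, b₁ - e₀ - y,
          by omega⟩
    · by_cases k₁ : e₁ < b₀
      · obtain ⟨y, hy⟩ : ∃ y, y = min (b₀ - e₁) (min (e₀ - b₁) e₂) := ⟨_, rfl⟩
        exact ⟨e₀ - b₁ - y, 0, e₂ - y, r + 1 - (b₀ - e₁ - y), b₁ + y, e₁, y, b₀ - e₁ - y,
          by omega⟩
      · exact ⟨e₀ - b₁, e₁ - b₀, e₂, r + 1, b₁, b₀, 0, 0, by omega⟩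

/-- Ideals of fat point schemes at three coordinate points multiply, provided that both
multiplicity sequences are increasing and satisfy the triangle inequality, and that one of them
has even sum. -/
theorem ptIdeal_pow_inf_mul (K : Type*) [Field K] {N : ℕ} (hN : 2 ≤ N)
    {a₀ a₁ a₂ b₀ b₁ b₂ : ℕ} (ha₀₁ : a₀ ≤ a₁) (ha₁₂ : a₁ ≤ a₂) (ha : a₂ ≤ a₀ + a₁)
    (hb₀₁ : b₀ ≤ b₁) (hb₁₂ : b₁ ≤ b₂) (hb : b₂ ≤ b₀ + b₁) (hev : Even (b₀ + b₁ + b₂)) :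
    ptIdeal K N 0 ^ (a₀ + b₀) ⊓ ptIdeal K N 1 ^ (a₁ + b₁) ⊓ ptIdeal K N 2 ^ (a₂ + b₂) =
      (ptIdeal K N 0 ^ a₀ ⊓ ptIdeal K N 1 ^ a₁ ⊓ ptIdeal K N 2 ^ a₂) *
        (ptIdeal K N 0 ^ b₀ ⊓ ptIdeal K N 1 ^ b₁ ⊓ ptIdeal K N 2 ^ b₂) := by
  apply le_antisymm
  · intro x hx
    simp only [Submodule.mem_inf, mem_ptIdeal_pow_iff] at hx
    obtain ⟨⟨hx₀, hx₁⟩, hx₂⟩ := hx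
    rw [x.as_sum]
    refine Ideal.sum_mem _ fun e he ↦ ?_
    specialize hx₀ e he
    specialize hx₁ e he
    specialize hx₂ e he
    have h01 : (0 : Fin (N + 1)) ≠ 1 := by
      simp [Fin.ext_iff, Nat.mod_eq_of_lt (show 1 < N + 1 by omega)]
    have h02 : (0 : Fin (N + 1)) ≠ 2 := by
      simp [Fin.ext_iff, Nat.mod_eq_of_lt (show 2 < N + 1 by omega)]
    have h12 : (1 : Fin (N + 1)) ≠ 2 := by
      simp [Fin.ext_iff, Nat.mod_eq_of_lt (show 1 < N + 1 by omega),
        Nat.mod_eq_of_lt (show 2 < N + 1 by omega)]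
    obtain ⟨ρ, hρ⟩ : ∃ ρ, ρ = ((e.erase 0).erase 1).erase 2 := ⟨_, rfl⟩
    have hdeg : ρ.degree + e 2 + e 1 + e 0 = e.degree := by
      rw [← Finsupp.degree_erase_add e 0, ← Finsupp.degree_erase_add (e.erase 0) 1,
        ← Finsupp.degree_erase_add ((e.erase 0).erase 1) 2, hρ]
      simp [h01.symm, h02.symm, h12.symm]
    obtain ⟨f₀, f₁, f₂, s, g₀, g₁, g₂, t, hf₀, hf₁, hf₂, hs, hfg⟩ :=
      exists_exponent_splitting_s14 ρ.degree a₀ a₁ a₂ b₀ b₁ b₂ (e 0) (e 1) (e 2)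
        ha₀₁ ha₁₂ ha hb₀₁ hb₁₂ hb (.inr hev) (by omega) (by omega) (by omega)
    obtain ⟨τ, hτρ, hτ⟩ := Finsupp.exists_le_degree_eq ρ s (by omega)
    have hτ₀ : τ 0 = 0 := by simpa [hρ, h01, h02] using hτρ 0
    have hτ₁ : τ 1 = 0 := by simpa [hρ, h12] using hτρ 1
    have hτ₂ : τ 2 = 0 := by simpa [hρ] using hτρ 2
    obtain ⟨f, hf⟩ : ∃ f, f = Finsupp.single 0 f₀ + Finsupp.single 1 f₁ + Finsupp.single 2 f₂ + τ :=
      ⟨_, rfl⟩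
    have hff₀ : f 0 = f₀ := by simp [hf, hτ₀, h01, h02]
    have hff₁ : f 1 = f₁ := by simp [hf, hτ₁, h01.symm, h12]
    have hff₂ : f 2 = f₂ := by simp [hf, hτ₂, h02.symm, h12.symm]
    have hfd : f.degree = f₀ + f₁ + f₂ + s := by simp [hf, hτ, Finsupp.degree_single]
    have hfe : f ≤ e := fun i ↦ by
      by_cases hi₀ : i = 0
      · subst hi₀; omega
      by_cases hi₁ : i = 1
      · subst hi₁; omega
      by_cases hi₂ : i = 2
      · subst hi₂; omega
      simpa [hf, hρ, hi₀, hi₁, hi₂] using hτρ i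
    obtain ⟨g, rfl⟩ := exists_add_of_le hfe
    rw [map_add] at hdeg
    simp only [Finsupp.add_apply] at hdeg hf₀ hf₁ hf₂
    rw [show MvPolynomial.monomial (f + g) (x.coeff (f + g)) =
      MvPolynomial.monomial f 1 * MvPolynomial.monomial g (x.coeff (f + g)) by
        rw [MvPolynomial.monomial_mul, one_mul]]
    refine Ideal.mul_mem_mul ?_ ?_ <;> simp only [Submodule.mem_inf, mem_ptIdeal_pow_iff]
    · refine ⟨⟨?_, ?_⟩, ?_⟩ <;> intro d hd <;>
        obtain rfl := Finset.mem_singleton.mp (MvPolynomial.support_monomial_subset hd) <;> omega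
    · refine ⟨⟨?_, ?_⟩, ?_⟩ <;> intro d hd <;>
        obtain rfl := Finset.mem_singleton.mp (MvPolynomial.support_monomial_subset hd) <;> omega
  · simp only [pow_add]
    exact le_inf (le_inf
      (Ideal.mul_mono (inf_le_left.trans inf_le_left) (inf_le_left.trans inf_le_left))
      (Ideal.mul_mono (inf_le_left.trans inf_le_right) (inf_le_left.trans inf_le_right)))
      (Ideal.mul_mono inf_le_right inf_le_right)

/-- For `Z = m_0 P_0 + m_1 P_1 + m_2 P_2` at the three coordinate points of `P^N`
with `m_0 ≤ m_1 ≤ m_2`, `m_0 + m_1 > m_2`, and `m_0 + m_1 + m_2` odd: for every `k`,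
`I(Z)^{(k)} = I(P_0+P_1+P_2)^{(k)} · I((m_0−1)P_0+(m_1−1)P_1+(m_2−1)P_2)^{(k)}`, and the
second factor's `k`-th symbolic power equals its `k`-th ordinary power. -/
theorem three_points_odd_case_symbolic_factorization
    (K : Type*) [Field K] (N : ℕ) (hN : 2 ≤ N) (m0 m1 m2 : ℕ)
    (h01 : m0 ≤ m1) (h12 : m1 ≤ m2)
    (hgt : m2 < m0 + m1) (hodd : Odd (m0 + m1 + m2)) (k : ℕ) :
    (ptIdeal K N 0 ^ (k * m0) ⊓ ptIdeal K N 1 ^ (k * m1) ⊓ ptIdeal K N 2 ^ (k * m2) =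
      (ptIdeal K N 0 ^ k ⊓ ptIdeal K N 1 ^ k ⊓ ptIdeal K N 2 ^ k) *
        (ptIdeal K N 0 ^ (k * (m0 - 1)) ⊓ ptIdeal K N 1 ^ (k * (m1 - 1)) ⊓
          ptIdeal K N 2 ^ (k * (m2 - 1)))) ∧
    (ptIdeal K N 0 ^ (k * (m0 - 1)) ⊓ ptIdeal K N 1 ^ (k * (m1 - 1)) ⊓
        ptIdeal K N 2 ^ (k * (m2 - 1)) =
      (ptIdeal K N 0 ^ (m0 - 1) ⊓ ptIdeal K N 1 ^ (m1 - 1) ⊓ ptIdeal K N 2 ^ (m2 - 1)) ^ k) := by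
  obtain ⟨b₀, rfl⟩ : ∃ b, m0 = b + 1 := ⟨m0 - 1, by omega⟩
  obtain ⟨b₁, rfl⟩ : ∃ b, m1 = b + 1 := ⟨m1 - 1, by omega⟩
  obtain ⟨b₂, rfl⟩ : ∃ b, m2 = b + 1 := ⟨m2 - 1, by omega⟩
  simp only [Nat.add_sub_cancel]
  have hb₀₁ : b₀ ≤ b₁ := by omega
  have hb₁₂ : b₁ ≤ b₂ := by omega
  have hb : b₂ ≤ b₀ + b₁ := by grind
  have hev : Even (b₀ + b₁ + b₂) := by grind
  have hkb (k : ℕ) : k * b₂ ≤ k * b₀ + k * b₁ := by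
    rw [← mul_add]; exact Nat.mul_le_mul_left k hb
  constructor
  · simp only [mul_add, mul_one, add_comm _ k]
    refine ptIdeal_pow_inf_mul K hN le_rfl le_rfl (by omega) (Nat.mul_le_mul_left k hb₀₁)
      (Nat.mul_le_mul_left k hb₁₂) (hkb k) ?_
    rw [← mul_add, ← mul_add]
    exact hev.mul_left k
  · induction k with
    | zero => simp
    | succ k ih =>
      rw [pow_succ, ← ih]
      simp only [add_mul, one_mul]
      exact ptIdeal_pow_inf_mul K hN (Nat.mul_le_mul_left k hb₀₁)
        (Nat.mul_le_mul_left k hb₁₂) (hkb k) hb₀₁ hb₁₂ hb hev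
end

section
/- Let I = I'(P_0) ∩ I'(P_1) ∩ I'(P_2) = (x_1,x_2) ∩ (x_0,x_2) ∩ (x_0,x_1) be the ideal of the three coordinate points of P^2 in R' = K[x_0,x_1,x_2], with symbolic powers I^{(m)} = I'(P_0)^m ∩ I'(P_1)^m ∩ I'(P_2)^m. Then ρ(I) = 4/3. -/
/-- The ideal of the `j`-th coordinate point of `P^2`, generated by the two
variables `x_i` with `i ≠ j`. -/
noncomputable def ptIdeal3 (K : Type*) [Field K] (j : Fin 3) :
    Ideal (MvPolynomial (Fin 3) K) :=
  Ideal.span {f | ∃ i : Fin 3, i ≠ j ∧ f = MvPolynomial.X i}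

open MvPolynomial in
/-- The ideal of polynomials all of whose monomials have `w`-weight at least `n`. -/
noncomputable def weightIdeal {σ : Type*} (K : Type*) [CommSemiring K] (w : σ → ℕ) (n : ℕ) :
    Ideal (MvPolynomial σ K) where
  carrier := {f | ∀ d ∈ f.support, n ≤ Finsupp.weight w d}
  zero_mem' := by simp
  add_mem' := by
    classical
    intro f g hf hg d hd
    rcases Finset.mem_union.1 (support_add hd) with h | h
    exacts [hf d h, hg d h]
  smul_mem' := by
    classical
    intro c f hf d hd
    obtain ⟨a, -, b, hb, rfl⟩ := Finset.mem_add.1 (support_mul c f hd)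
    rw [map_add]
    exact le_add_left (hf b hb)

section

open MvPolynomial

theorem weightIdeal_mul_le {σ K : Type*} [CommSemiring K] (w : σ → ℕ) (m n : ℕ) :
    weightIdeal K w m * weightIdeal K w n ≤ weightIdeal K w (m + n) := by
  classical
  refine Ideal.mul_le.2 fun f hf g hg d hd => ?_
  obtain ⟨a, ha, b, hb, rfl⟩ := Finset.mem_add.1 (support_mul f g hd)
  rw [map_add]
  exact add_le_add (hf a ha) (hg b hb)

theorem pow_le_weightIdeal {σ K : Type*} [CommSemiring K] {w : σ → ℕ} {n : ℕ}
    {I : Ideal (MvPolynomial σ K)} (h : I ≤ weightIdeal K w n) (r : ℕ) :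
    I ^ r ≤ weightIdeal K w (n * r) := by
  induction r with
  | zero => exact fun f _ d _ => by simp
  | succ r ih =>
    rw [pow_succ, mul_add_one]
    exact (Ideal.mul_mono ih h).trans (weightIdeal_mul_le w _ _)

theorem weight_fin_three (w : Fin 3 → ℕ) (d : Fin 3 →₀ ℕ) :
    Finsupp.weight w d = d 0 * w 0 + d 1 * w 1 + d 2 * w 2 := by
  rw [Finsupp.weight_apply, Finsupp.sum_fintype _ _ (by simp), Fin.sum_univ_three]
  simp only [smul_eq_mul]

variable {K : Type*} [Field K]

theorem X_mem_ptIdeal3 {i j : Fin 3} (h : i ≠ j) : X i ∈ ptIdeal3 K j :=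
  Ideal.subset_span ⟨i, h, rfl⟩

theorem ptIdeal3_le_weightIdeal (j : Fin 3) :
    ptIdeal3 K j ≤ weightIdeal K (fun i => if i = j then 0 else 1) 1 := by
  refine Ideal.span_le.2 ?_
  rintro _ ⟨i, hi, rfl⟩ d hd
  rw [support_X, Finset.mem_singleton] at hd
  subst hd
  simp [Finsupp.weight_single, hi]

theorem le_of_mem_support_of_mem_symbolicPower {m : ℕ} {f : MvPolynomial (Fin 3) K}
    (hf : f ∈ ptIdeal3 K 0 ^ m ⊓ ptIdeal3 K 1 ^ m ⊓ ptIdeal3 K 2 ^ m)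
    {d : Fin 3 →₀ ℕ} (hd : d ∈ f.support) :
    m ≤ d 1 + d 2 ∧ m ≤ d 0 + d 2 ∧ m ≤ d 0 + d 1 := by
  have key (j : Fin 3) (hj : f ∈ ptIdeal3 K j ^ m) :=
    pow_le_weightIdeal (ptIdeal3_le_weightIdeal j) m hj d hd
  have h0 := key 0 hf.1.1
  have h1 := key 1 hf.1.2
  have h2 := key 2 hf.2
  rw [weight_fin_three] at h0 h1 h2
  exact ⟨by simpa using h0, by simpa using h1, by simpa using h2⟩

theorem X_mul_X_mem_inf_ptIdeal3 {i j : Fin 3} (h : i ≠ j) :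
    (X i * X j : MvPolynomial (Fin 3) K) ∈ ptIdeal3 K 0 ⊓ ptIdeal3 K 1 ⊓ ptIdeal3 K 2 := by
  have key (k : Fin 3) : (X i * X j : MvPolynomial (Fin 3) K) ∈ ptIdeal3 K k := by
    by_cases hk : i = k
    · exact Ideal.mul_mem_left _ _ (X_mem_ptIdeal3 (hk ▸ h.symm))
    · exact Ideal.mul_mem_right _ _ (X_mem_ptIdeal3 hk)
  exact ⟨⟨key 0, key 1⟩, key 2⟩

theorem monomial_fin_three (d : Fin 3 →₀ ℕ) (c : K) :
    monomial d c = C c * (X 0 ^ d 0 * X 1 ^ d 1 * X 2 ^ d 2) := by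
  rw [monomial_eq, Finsupp.prod_fintype _ _ (by simp), Fin.prod_univ_three]

theorem monomial_mem_inf_ptIdeal3_pow {r : ℕ} {d : Fin 3 →₀ ℕ} (c : K)
    (h0 : r ≤ d 1 + d 2) (h1 : r ≤ d 0 + d 2) (h2 : r ≤ d 0 + d 1)
    (h : 2 * r ≤ d 0 + d 1 + d 2) :
    monomial d c ∈ (ptIdeal3 K 0 ⊓ ptIdeal3 K 1 ⊓ ptIdeal3 K 2) ^ r := by
  obtain ⟨i, j, k, hr, a, b, e, ha, hb, he⟩ : ∃ i j k, r = i + j + k ∧ ∃ a b e,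
      d 0 = i + k + a ∧ d 1 = i + j + b ∧ d 2 = j + k + e :=
    ⟨r - (r - d 0) - (r - d 1), r - d 0, r - d 1, by omega,
      d 0 - (r - (r - d 0)), d 1 - (r - (r - d 1)),
      d 2 - ((r - d 0) + (r - d 1)), by omega, by omega, by omega⟩
  have hmem : ((X 0 * X 1) ^ i * (X 1 * X 2) ^ j * (X 0 * X 2) ^ k : MvPolynomial (Fin 3) K) ∈
      (ptIdeal3 K 0 ⊓ ptIdeal3 K 1 ⊓ ptIdeal3 K 2) ^ r := by
    rw [hr, pow_add, pow_add]
    exact Ideal.mul_mem_mul (Ideal.mul_mem_mul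
      (Ideal.pow_mem_pow (X_mul_X_mem_inf_ptIdeal3 (by decide)) i)
      (Ideal.pow_mem_pow (X_mul_X_mem_inf_ptIdeal3 (by decide)) j))
      (Ideal.pow_mem_pow (X_mul_X_mem_inf_ptIdeal3 (by decide)) k)
  convert Ideal.mul_mem_left _ (C c * (X 0 ^ a * X 1 ^ b * X 2 ^ e)) hmem using 1
  rw [monomial_fin_three, ha, hb, he]
  ring

theorem symbolicPower_le_inf_ptIdeal3_pow {m r : ℕ} (h : 4 * r ≤ 3 * m) :
    ptIdeal3 K 0 ^ m ⊓ ptIdeal3 K 1 ^ m ⊓ ptIdeal3 K 2 ^ m ≤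
      (ptIdeal3 K 0 ⊓ ptIdeal3 K 1 ⊓ ptIdeal3 K 2) ^ r := by
  intro f hf
  rw [f.as_sum]
  refine Ideal.sum_mem _ fun d hd => ?_
  obtain ⟨h0, h1, h2⟩ := le_of_mem_support_of_mem_symbolicPower hf hd
  exact monomial_mem_inf_ptIdeal3_pow _ (by omega) (by omega) (by omega) (by omega)

theorem inf_ptIdeal3_le_weightIdeal :
    ptIdeal3 K 0 ⊓ ptIdeal3 K 1 ⊓ ptIdeal3 K 2 ≤ weightIdeal K (fun _ => 1) 2 := by
  intro f hf d hd
  obtain ⟨h0, h1, h2⟩ := le_of_mem_support_of_mem_symbolicPower (m := 1) (by simpa using hf) hd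
  rw [weight_fin_three]
  omega

theorem prod_X_pow_mem_symbolicPower (t : ℕ) :
    (X 0 ^ t * X 1 ^ t * X 2 ^ t : MvPolynomial (Fin 3) K) ∈
      ptIdeal3 K 0 ^ (2 * t) ⊓ ptIdeal3 K 1 ^ (2 * t) ⊓ ptIdeal3 K 2 ^ (2 * t) := by
  have key (i j k : Fin 3) (hi : i ≠ k) (hj : j ≠ k) :
      (X k ^ t * (X i ^ t * X j ^ t) : MvPolynomial (Fin 3) K) ∈ ptIdeal3 K k ^ (2 * t) := by
    rw [two_mul, pow_add]
    exact Ideal.mul_mem_left _ _ (Ideal.mul_mem_mul (Ideal.pow_mem_pow (X_mem_ptIdeal3 hi) t)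
      (Ideal.pow_mem_pow (X_mem_ptIdeal3 hj) t))
  refine ⟨⟨?_, ?_⟩, ?_⟩
  · rw [mul_assoc]
    exact key 1 2 0 (by decide) (by decide)
  · rw [mul_comm (X 0 ^ t), mul_assoc]
    exact key 0 2 1 (by decide) (by decide)
  · rw [mul_comm (X 0 ^ t * X 1 ^ t)]
    exact key 0 1 2 (by decide) (by decide)

theorem not_symbolicPower_le_inf_ptIdeal3_pow {t r : ℕ} (h : 3 * t < 2 * r) :
    ¬ ptIdeal3 K 0 ^ (2 * t) ⊓ ptIdeal3 K 1 ^ (2 * t) ⊓ ptIdeal3 K 2 ^ (2 * t) ≤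
      (ptIdeal3 K 0 ⊓ ptIdeal3 K 1 ⊓ ptIdeal3 K 2) ^ r := by
  intro hle
  let d : Fin 3 →₀ ℕ := Finsupp.equivFunOnFinite.symm fun _ => t
  have hd : monomial d (1 : K) = X 0 ^ t * X 1 ^ t * X 2 ^ t := by
    simp [monomial_fin_three, d]
  have hmem := pow_le_weightIdeal inf_ptIdeal3_le_weightIdeal r
    (hle (prod_X_pow_mem_symbolicPower t))
  rw [← hd] at hmem
  have hw := hmem d (by simp)
  rw [weight_fin_three] at hw
  simp only [d, Finsupp.equivFunOnFinite_symm_apply_apply] at hw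
  omega

end

/-- The resurgence of the ideal `I = (x_1,x_2) ∩ (x_0,x_2) ∩ (x_0,x_1)` of the three
coordinate points of `P^2` is `4/3`. -/
theorem resurgence_three_coordinate_points_P2
    (K : Type*) [Field K] :
    resurgence (ptIdeal3 K 0 ⊓ ptIdeal3 K 1 ⊓ ptIdeal3 K 2)
      (fun m => ptIdeal3 K 0 ^ m ⊓ ptIdeal3 K 1 ^ m ⊓ ptIdeal3 K 2 ^ m) =
      4 / 3 := by
  have hmem (s : ℕ) (hs : 0 < s) := not_symbolicPower_le_inf_ptIdeal3_pow (K := K)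
    (t := 2 * s) (r := 3 * s + 1) (by omega)
  refine csSup_eq_of_forall_le_of_forall_lt_exists_gt
    ⟨_, 2 * (2 * 1), 3 * 1 + 1, by omega, by omega, hmem 1 one_pos, rfl⟩ ?_ ?_
  · rintro x ⟨m, r, -, hr, hnot, rfl⟩
    have h : 3 * m < 4 * r := by
      by_contra! h
      exact hnot (symbolicPower_le_inf_ptIdeal3_pow h)
    have h' : (3 * m : ℝ) < 4 * r := by exact_mod_cast h
    rw [div_le_div_iff₀ (by exact_mod_cast hr) (by norm_num)]
    linarith
  · intro x hx
    obtain ⟨s, hs⟩ := exists_nat_gt (max 0 (x / (4 - 3 * x)))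
    obtain ⟨hs0, hsx⟩ := max_lt_iff.1 hs
    have hs' : 0 < s := by exact_mod_cast hs0
    refine ⟨_, ⟨2 * (2 * s), 3 * s + 1, by omega, by omega, hmem s hs', rfl⟩, ?_⟩
    rw [div_lt_iff₀ (by linarith)] at hsx
    push_cast
    rw [lt_div_iff₀ (by positivity)]
    linarith
end

section
/- Let P_0, P_1, P_2 be the coordinate points of P^N and J = I(P_0) ∩ I(P_1) ∩ I(P_2). Then for every integer r with 1 ≤ r ≤ 4: I(P_0)^r ∩ I(P_1)^r ∩ I(P_2)^r ⊆ J^{r−1}, i.e. I(P_0+P_1+P_2)^{(r)} ⊆ I(P_0+P_1+P_2)^{r−1}. -/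
/-- Powers of the ideal of a coordinate point only involve monomials of large degree in the
variables vanishing at that point. -/
theorem le_sum_erase_of_mem_ptIdeal_pow {K : Type*} [Field K] {N : ℕ} (j : Fin (N + 1)) (r : ℕ)
    {f : MvPolynomial (Fin (N + 1)) K} (hf : f ∈ ptIdeal K N j ^ r)
    {m : Fin (N + 1) →₀ ℕ} (hm : m ∈ f.support) :
    r ≤ ∑ i ∈ Finset.univ.erase j, m i := by
  have key : ptIdeal K N j ^ r ≤
      Ideal.span ((fun s => MvPolynomial.monomial s (1 : K)) ''
        {m : Fin (N + 1) →₀ ℕ | r ≤ ∑ i ∈ Finset.univ.erase j, m i}) := by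
    clear hf
    induction r with
    | zero =>
      refine le_top.trans (le_of_eq ?_)
      symm
      rw [Ideal.eq_top_iff_one]
      exact Ideal.subset_span ⟨0, by simp, rfl⟩
    | succ r ih =>
      rw [pow_succ]
      refine (Ideal.mul_mono_left ih).trans ?_
      rw [ptIdeal, Ideal.span_mul_span', Ideal.span_le]
      rintro _ ⟨_, ⟨s, hs, rfl⟩, _, ⟨i, hi, rfl⟩, rfl⟩
      refine Ideal.subset_span ⟨s + Finsupp.single i 1, ?_, ?_⟩
      · have h1 : ∑ k ∈ Finset.univ.erase j, (Finsupp.single i 1 : Fin (N + 1) →₀ ℕ) k = 1 := by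
          rw [Finset.sum_eq_single_of_mem i (by simp [hi])]
          · simp
          · intro k _ hk
            simp [hk.symm]
        simp only [Set.mem_ofPred_eq, Finsupp.add_apply, Finset.sum_add_distrib, h1] at hs ⊢
        lia
      · simp [MvPolynomial.X, MvPolynomial.monomial_mul]
  obtain ⟨s, hs, hle⟩ := MvPolynomial.mem_ideal_span_monomial_image.1 (key hf) m hm
  exact le_trans hs (Finset.sum_le_sum fun i _ => hle i)

/-- A triangle with vertex capacities `a`, `b`, `c`, any two of which sum to at least `s ≤ 4`,
has an edge multiset of size at least `s - 1` respecting the capacities. -/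
theorem exists_triangle_packing {a b c s : ℕ} (hs : s ≤ 4)
    (hbc : s ≤ b + c) (hac : s ≤ a + c) (hab : s ≤ a + b) :
    ∃ p q t : ℕ, p + q ≤ a ∧ p + t ≤ b ∧ q + t ≤ c ∧ s ≤ p + q + t + 1 := by
  by_contra! h
  have h000 := h 0 0 0
  have h100 := h 1 0 0
  have h010 := h 0 1 0
  have h001 := h 0 0 1
  have h200 := h 2 0 0
  have h020 := h 0 2 0
  have h002 := h 0 0 2
  have h110 := h 1 1 0
  have h101 := h 1 0 1
  have h011 := h 0 1 1
  have h300 := h 3 0 0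
  have h030 := h 0 3 0
  have h003 := h 0 0 3
  have h210 := h 2 1 0
  have h201 := h 2 0 1
  have h120 := h 1 2 0
  have h021 := h 0 2 1
  have h102 := h 1 0 2
  have h012 := h 0 1 2
  have h111 := h 1 1 1
  clear h
  lia

theorem X_mem_ptIdeal {K : Type*} [Field K] {N : ℕ} {i j : Fin (N + 1)} (h : i ≠ j) :
    (MvPolynomial.X i : MvPolynomial (Fin (N + 1)) K) ∈ ptIdeal K N j :=
  Ideal.subset_span ⟨i, h, rfl⟩

/-- For the three coordinate points of `P^N` with `J = I(P_0) ∩ I(P_1) ∩ I(P_2)`: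
for every `1 ≤ r ≤ 4`, `I(P_0)^r ∩ I(P_1)^r ∩ I(P_2)^r ⊆ J^{r−1}`. -/
theorem three_simple_points_containment
    (K : Type*) [Field K] (N : ℕ) (hN : 2 ≤ N) (r : ℕ) (hr1 : 1 ≤ r) (hr4 : r ≤ 4) :
    ptIdeal K N 0 ^ r ⊓ ptIdeal K N 1 ^ r ⊓ ptIdeal K N 2 ^ r ≤
      (ptIdeal K N 0 ⊓ ptIdeal K N 1 ⊓ ptIdeal K N 2) ^ (r - 1) := by
  obtain ⟨n, rfl⟩ := Nat.exists_eq_add_of_le' hN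
  have h01 : (0 : Fin (n + 2 + 1)) ≠ 1 := by simp
  have h02 : (0 : Fin (n + 2 + 1)) ≠ 2 := by
    simp [Fin.ext_iff, Nat.mod_eq_of_lt (show 2 < n + 2 + 1 by lia)]
  have h12 : (1 : Fin (n + 2 + 1)) ≠ 2 := by
    simp [Fin.ext_iff, Nat.mod_eq_of_lt (show 2 < n + 2 + 1 by lia)]
  rintro f ⟨⟨hf0, hf1⟩, hf2⟩
  set J := ptIdeal K (n + 2) 0 ⊓ ptIdeal K (n + 2) 1 ⊓ ptIdeal K (n + 2) 2
  rw [f.as_sum]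
  refine Ideal.sum_mem _ fun m hm => ?_
  have e0 := le_sum_erase_of_mem_ptIdeal_pow 0 r hf0 hm
  have e1 := le_sum_erase_of_mem_ptIdeal_pow 1 r hf1 hm
  have e2 := le_sum_erase_of_mem_ptIdeal_pow 2 r hf2 hm
  let S : Finset (Fin (n + 2 + 1)) := ((Finset.univ.erase 0).erase 1).erase 2
  have sum_split : ∑ i, m i = m 0 + (m 1 + (m 2 + ∑ i ∈ S, m i)) := by
    rw [Finset.add_sum_erase _ _ (by simp [h02.symm, h12.symm]),
      Finset.add_sum_erase _ _ (by simp), Finset.add_sum_erase _ _ (by simp)]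
  have prod_split : ∏ i, (MvPolynomial.X i : MvPolynomial _ K) ^ m i =
      MvPolynomial.X 0 ^ m 0 * (MvPolynomial.X 1 ^ m 1 *
        (MvPolynomial.X 2 ^ m 2 * ∏ i ∈ S, MvPolynomial.X i ^ m i)) := by
    rw [Finset.mul_prod_erase _ (fun i => (MvPolynomial.X i : MvPolynomial _ K) ^ m i)
        (by simp [h02.symm, h12.symm]),
      Finset.mul_prod_erase _ (fun i => (MvPolynomial.X i : MvPolynomial _ K) ^ m i) (by simp),
      Finset.mul_prod_erase _ (fun i => (MvPolynomial.X i : MvPolynomial _ K) ^ m i) (by simp)]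
  have t0 := Finset.add_sum_erase Finset.univ m (Finset.mem_univ 0)
  have t1 := Finset.add_sum_erase Finset.univ m (Finset.mem_univ 1)
  have t2 := Finset.add_sum_erase Finset.univ m (Finset.mem_univ 2)
  have hS : ∏ i ∈ S, (MvPolynomial.X i : MvPolynomial _ K) ^ m i ∈ J ^ ∑ i ∈ S, m i := by
    rw [← Finset.prod_pow_eq_pow_sum]
    refine Ideal.prod_mem_prod fun i hi => Ideal.pow_mem_pow ?_ _
    simp only [S, Finset.mem_erase, Finset.mem_univ, and_true] at hi
    exact ⟨⟨X_mem_ptIdeal hi.2.2, X_mem_ptIdeal hi.2.1⟩, X_mem_ptIdeal hi.1⟩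
  have m01 : (MvPolynomial.X 0 * MvPolynomial.X 1 : MvPolynomial _ K) ∈ J :=
    ⟨⟨Ideal.mul_mem_left _ _ (X_mem_ptIdeal h01.symm), Ideal.mul_mem_right _ _ (X_mem_ptIdeal h01)⟩,
      Ideal.mul_mem_right _ _ (X_mem_ptIdeal h02)⟩
  have m02 : (MvPolynomial.X 0 * MvPolynomial.X 2 : MvPolynomial _ K) ∈ J :=
    ⟨⟨Ideal.mul_mem_left _ _ (X_mem_ptIdeal h02.symm), Ideal.mul_mem_right _ _ (X_mem_ptIdeal h01)⟩,
      Ideal.mul_mem_right _ _ (X_mem_ptIdeal h02)⟩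
  have m12 : (MvPolynomial.X 1 * MvPolynomial.X 2 : MvPolynomial _ K) ∈ J :=
    ⟨⟨Ideal.mul_mem_left _ _ (X_mem_ptIdeal h02.symm),
      Ideal.mul_mem_left _ _ (X_mem_ptIdeal h12.symm)⟩,
      Ideal.mul_mem_right _ _ (X_mem_ptIdeal h12)⟩
  obtain ⟨p, q, t, ha, hb, hc, hs⟩ := exists_triangle_packing (a := m 0) (b := m 1) (c := m 2)
    (s := r - ∑ i ∈ S, m i) (by lia) (by lia) (by lia) (by lia)
  have hmem := Ideal.mul_mem_mul (Ideal.mul_mem_mul (Ideal.mul_mem_mul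
    (Ideal.pow_mem_pow m01 p) (Ideal.pow_mem_pow m02 q)) (Ideal.pow_mem_pow m12 t)) hS
  rw [← pow_add, ← pow_add, ← pow_add] at hmem
  rw [MvPolynomial.monomial_eq, Finsupp.prod_fintype _ _ (by simp), prod_split]
  refine Ideal.mul_mem_left _ _ (Ideal.mem_of_dvd _ ?_ (Ideal.pow_le_pow_right (by lia) hmem))
  calc _ = MvPolynomial.X 0 ^ (p + q) * (MvPolynomial.X 1 ^ (p + t) *
        (MvPolynomial.X 2 ^ (q + t) * ∏ i ∈ S, (MvPolynomial.X i : MvPolynomial _ K) ^ m i)) := by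
        ring
    _ ∣ _ := mul_dvd_mul (pow_dvd_pow _ ha) (mul_dvd_mul (pow_dvd_pow _ hb)
        (mul_dvd_mul (pow_dvd_pow _ hc) dvd_rfl))
end
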